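/- Let (R, m) be a Noetherian complete local ring. Then R is pure injective as a module over itself. -/

import Mathlib

universe u

/-- A linear map is a pure monomorphism if it is injective and remains injective after
tensoring with every `R`-module. -/
def IsPureMono (R : Type u) [CommRing R] {M N : Type u} [AddCommGroup M] [Module R M]
    [AddCommGroup N] [Module R N] (f : M →ₗ[R] N) : Prop :=
  Function.Injective f ∧
    ∀ (L : Type u) [AddCommGroup L] [Module R L], Function.Injective (LinearMap.rTensor L f)

/-- A module `D` is pure injective if every homomorphism into `D` extends along every
pure monomorphism. -/
def IsPureInjective (R : Type u) [CommRing R] (D : Type u) [AddCommGroup D] [Module R D] :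
    Prop :=
  ∀ (M N : Type u) [AddCommGroup M] [Module R M] [AddCommGroup N] [Module R N]
    (f : M →ₗ[R] N), IsPureMono R f → ∀ g : M →ₗ[R] D, ∃ h : N →ₗ[R] D, h ∘ₗ f = g

/-- A module is finitely embedded if it embeds into the injective envelope of a direct sum
of finitely many simple modules, i.e. into an injective module which is an essential
extension of a finitely generated semisimple submodule. -/
def FinitelyEmbedded (R : Type u) [CommRing R] (M : Type u) [AddCommGroup M] [Module R M] :
    Prop :=
  ∃ E : ModuleCat.{u} R, Module.Injective R E ∧
    ∃ S : Submodule R E, IsSemisimpleModule R S ∧ S.FG ∧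
      (∀ P : Submodule R E, P ≠ ⊥ → S ⊓ P ≠ ⊥) ∧
      ∃ f : M →ₗ[R] E, Function.Injective f

open scoped TensorProduct

theorem IsPureMono.exists_solution {R : Type u} [CommRing R] {M N : Type u} [AddCommGroup M]
    [Module R M] [AddCommGroup N] [Module R N] {f : M →ₗ[R] N} (hf : IsPureMono R f)
    {ι κ : Type} [Fintype ι] [Fintype κ] (A : ι → κ → R) (m : ι → M) (n : κ → N)
    (h : ∀ i, f (m i) = ∑ l, A i l • n l) :
    ∃ m' : κ → M, ∀ i, m i = ∑ l, A i l • m' l := by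
  classical
  let S : Submodule R (ι → R) := LinearMap.range (Matrix.mulVecLin (Matrix.of A))
  let e : ι → (ι → R) ⧸ S := fun i => S.mkQ (Pi.single i 1)
  have he (a : ι → R) : ∑ i, a i • e i = S.mkQ a := by
    simp only [e, ← map_smul, ← map_sum]
    congr 1
    exact (pi_eq_sum_univ' a).symm
  have hspan : Submodule.span R (Set.range e) = ⊤ := by
    refine eq_top_iff.2 fun x _ => ?_
    obtain ⟨a, rfl⟩ := S.mkQ_surjective x
    rw [← he]
    exact Submodule.sum_mem _ fun i _ =>
      Submodule.smul_mem _ _ (Submodule.subset_span ⟨i, rfl⟩)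
  have hcol (l : κ) : ∑ i, A i l • e i = 0 := by
    rw [he fun i => A i l, Submodule.mkQ_apply, Submodule.Quotient.mk_eq_zero]
    refine ⟨Pi.single l 1, ?_⟩
    ext i
    simp
  have hN : ∑ i, f (m i) ⊗ₜ[R] e i = 0 := by
    simp_rw [h, TensorProduct.sum_tmul, TensorProduct.smul_tmul]
    rw [Finset.sum_comm]
    simp_rw [← TensorProduct.tmul_sum, hcol, TensorProduct.tmul_zero, Finset.sum_const_zero]
  have hM : ∑ i, m i ⊗ₜ[R] e i = 0 := by
    apply hf.2 ((ι → R) ⧸ S)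
    rw [map_sum, map_zero, ← hN]
    simp only [LinearMap.rTensor_tmul]
  have hM' : ∑ i, e i ⊗ₜ[R] m i = 0 := by
    simpa using congrArg (TensorProduct.comm R M ((ι → R) ⧸ S)) hM
  obtain ⟨k, a, y, hy, ha⟩ := TensorProduct.vanishesTrivially_of_sum_tmul_eq_zero R hspan hM'
  have hS (j : Fin k) : ∃ c : κ → R, ∀ i, a i j = ∑ l, A i l * c l := by
    have h0 := ha j
    rw [he fun i => a i j, Submodule.mkQ_apply, Submodule.Quotient.mk_eq_zero] at h0
    obtain ⟨c, hc⟩ := h0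
    exact ⟨c, fun i => (congrFun hc i).symm⟩
  choose c hc using hS
  refine ⟨fun l => ∑ j, c j l • y j, fun i => ?_⟩
  simp_rw [hy i, hc, Finset.sum_smul, Finset.smul_sum, smul_smul]
  exact Finset.sum_comm

theorem isArtinianRing_quotient_maximalIdeal_pow (R : Type*) [CommRing R] [IsNoetherianRing R]
    [IsLocalRing R] (n : ℕ) : IsArtinianRing (R ⧸ IsLocalRing.maximalIdeal R ^ n) := by
  have : Ring.KrullDimLE 0 (R ⧸ IsLocalRing.maximalIdeal R ^ n) :=
    Ring.krullDimLE_zero_iff.mpr fun J prime ↦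
      Ideal.isMaximal_of_isIntegral_of_isMaximal_comap _ <| by
        have hJ := prime.comap (Ideal.Quotient.mk (IsLocalRing.maximalIdeal R ^ n))
        have hle : IsLocalRing.maximalIdeal R ^ n ≤
            J.comap (Ideal.Quotient.mk (IsLocalRing.maximalIdeal R ^ n)) :=
          .trans (by simp) (Ideal.ker_le_comap _)
        convert! IsLocalRing.maximalIdeal.isMaximal R
        exact le_antisymm (IsLocalRing.le_maximalIdeal hJ.1) (hJ.le_of_pow_le hle)
  exact IsNoetherianRing.isArtinianRing_of_krullDimLE_zero

/-- A nonempty family of ideal cosets has a member which is minimal modulo a given power of the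
maximal ideal. -/
theorem exists_coset_minimal_mod_pow {R : Type*} [CommRing R] [IsNoetherianRing R]
    [IsLocalRing R] {S : Set (Set R)} (hne : S.Nonempty)
    (hS : ∀ C ∈ S, ∃ (a : R) (I : Ideal R), C = {r | r - a ∈ I}) (n : ℕ) :
    ∃ C ∈ S, ∀ D ∈ S, D ⊆ C → ∀ r ∈ C, ∃ s ∈ D, r - s ∈ IsLocalRing.maximalIdeal R ^ n := by
  have := isArtinianRing_quotient_maximalIdeal_pow R n
  let T : Set (Ideal (R ⧸ IsLocalRing.maximalIdeal R ^ n)) :=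
    {J | ∃ (a : R) (I : Ideal R), {r | r - a ∈ I} ∈ S ∧ J = I.map (Ideal.Quotient.mk _)}
  have hT : T.Nonempty := by
    obtain ⟨C, hC⟩ := hne
    obtain ⟨a, I, rfl⟩ := hS C hC
    exact ⟨_, a, I, hC, rfl⟩
  obtain ⟨_, ⟨a, I, hC, rfl⟩, hmin⟩ := IsArtinian.set_has_minimal T hT
  refine ⟨_, hC, fun D hD hDC r hr => ?_⟩
  obtain ⟨b, J, rfl⟩ := hS D hD
  have hb : b - a ∈ I := hDC (by simp)
  have hJI : J ≤ I := fun j hj => by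
    have h : b + j - a ∈ I := hDC (by simpa using hj)
    have := I.sub_mem h hb
    ring_nf at this
    exact this
  have hmap := eq_of_le_of_not_lt (Ideal.map_mono hJI) (hmin _ ⟨b, J, hD, rfl⟩)
  have hr' : r - b ∈ I := by simpa using I.sub_mem hr hb
  have hmem : r - b ∈ J ⊔ IsLocalRing.maximalIdeal R ^ n := by
    have h := Ideal.mem_map_of_mem (Ideal.Quotient.mk (IsLocalRing.maximalIdeal R ^ n)) hr'
    rw [← hmap, ← Ideal.mem_comap,
      Ideal.comap_map_of_surjective' _ Ideal.Quotient.mk_surjective, Ideal.mk_ker] at h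
    exact h
  obtain ⟨j, hj, t, ht, hjt⟩ := Submodule.mem_sup.1 hmem
  refine ⟨b + j, by simpa using hj, ?_⟩
  rwa [← sub_sub, ← hjt, add_sub_cancel_left]

/-- A complete Noetherian local ring is linearly compact: a family of ideal cosets closed under
intersection has a common point. -/
theorem exists_mem_of_isAdicComplete {R : Type*} [CommRing R] [IsNoetherianRing R]
    [IsLocalRing R] [IsAdicComplete (IsLocalRing.maximalIdeal R) R] (S : Set (Set R))
    (hS : ∀ C ∈ S, ∃ (a : R) (I : Ideal R), C = {r | r - a ∈ I})
    (hinter : ∀ C ∈ S, ∀ D ∈ S, C ∩ D ∈ S) : ∃ r, ∀ C ∈ S, r ∈ C := by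
  obtain rfl | hne := S.eq_empty_or_nonempty
  · simp
  choose C hC hmin using exists_coset_minimal_mod_pow hne hS
  let D : ℕ → Set R := fun n => Nat.rec (C 0) (fun k E => E ∩ C (k + 1)) n
  have hD (n : ℕ) : D n ∈ S := by
    induction n with
    | zero => exact hC 0
    | succ k ih => exact hinter _ ih _ (hC _)
  have hDC (n : ℕ) : D n ⊆ C n := by
    cases n with
    | zero => exact subset_rfl
    | succ k => exact Set.inter_subset_right
  have hstep (n : ℕ) (x : D n) :
      ∃ y : D (n + 1), x.1 - y.1 ∈ IsLocalRing.maximalIdeal R ^ n := by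
    obtain ⟨s, hs, h⟩ := hmin n (D (n + 1)) (hD (n + 1))
      (Set.inter_subset_left.trans (hDC n)) x.1 (hDC n x.2)
    exact ⟨⟨s, hs⟩, h⟩
  choose next hnext using hstep
  have h0 : (D 0).Nonempty := by
    obtain ⟨a, I, h⟩ := hS _ (hD 0)
    exact ⟨a, by simp [h]⟩
  let x : (n : ℕ) → D n := fun n => Nat.rec ⟨h0.some, h0.some_mem⟩ next n
  have hx (n : ℕ) : (x n).1 - (x (n + 1)).1 ∈ IsLocalRing.maximalIdeal R ^ n := hnext n (x n)
  obtain ⟨r, hr⟩ := IsPrecomplete.prec'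
    (I := IsLocalRing.maximalIdeal R) (fun n => (x n).1) (fun {m n} hmn => by
      rw [SModEq.sub_mem, smul_eq_mul, Ideal.mul_top]
      induction n, hmn using Nat.le_induction with
      | base => simp
      | succ k hk ih =>
        simpa using add_mem ih (Ideal.pow_le_pow_right hk (hx k)))
  refine ⟨r, fun E hE => ?_⟩
  obtain ⟨a, I, rfl⟩ := hS E hE
  have hclosed : Ideal.Quotient.mk I (r - a) = 0 := by
    refine IsHausdorff.haus (inferInstance : IsHausdorff (IsLocalRing.maximalIdeal R) (R ⧸ I))
      _ fun n => ?_
    obtain ⟨s, hs, hxs⟩ := hmin n _ (hinter _ hE _ (hD n))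
      (Set.inter_subset_right.trans (hDC n)) (x n).1 (hDC n (x n).2)
    have hxr := hr n
    rw [SModEq.sub_mem, smul_eq_mul, Ideal.mul_top] at hxr
    have hrs : r - s ∈ IsLocalRing.maximalIdeal R ^ n := by
      simpa using sub_mem hxs hxr
    have heq : Ideal.Quotient.mk I (r - a) = (r - s) • (1 : R ⧸ I) := by
      rw [Algebra.smul_def, mul_one]
      exact Ideal.Quotient.eq.2 (by simpa using hs.1)
    rw [SModEq.zero, heq]
    exact Submodule.smul_mem_smul hrs trivial
  exact Ideal.Quotient.eq_zero_iff_mem.1 hclosed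

/-- Every finite system of linear equations over `R` that is solvable in `X ⧸ K`, where the
constants are taken along `r ↦ r • e`, is solvable in `R`. -/
def ReflectsFiniteSystems {R X : Type*} [CommRing R] [AddCommGroup X] [Module R X] (e : X)
    (K : Submodule R X) : Prop :=
  ∀ (ι κ : Type) [Fintype ι] [Fintype κ] (A : ι → κ → R) (b : ι → R) (x : κ → X),
    (∀ i, b i • e - ∑ l, A i l • x l ∈ K) → ∃ y : κ → R, ∀ i, b i = ∑ l, A i l * y l

namespace ReflectsFiniteSystems

variable {R X : Type*} [CommRing R] [AddCommGroup X] [Module R X] {e : X}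

theorem exists_maximal {K : Submodule R X} (hK : ReflectsFiniteSystems e K) :
    ∃ K', K ≤ K' ∧ Maximal (ReflectsFiniteSystems e) K' := by
  refine zorn_le_nonempty₀ {K | ReflectsFiniteSystems e K} (fun c hc hchain y hy => ?_) K hK
  refine ⟨sSup c, fun ι κ _ _ A b x h => ?_, fun z hz => le_sSup hz⟩
  have hcpt := (Submodule.fg_iff_compact _).1 (Submodule.fg_span (R := R)
    (Set.finite_range fun i => b i • e - ∑ l, A i l • x l))
  rw [CompleteLattice.isCompactElement_iff_le_of_directed_sSup_le] at hcpt
  obtain ⟨K', hK', hle⟩ := hcpt c ⟨y, hy⟩ hchain.directedOn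
    (Submodule.span_le.2 (by rintro _ ⟨i, rfl⟩; exact h i))
  exact hc hK' ι κ A b x fun i => hle (Submodule.subset_span ⟨i, rfl⟩)

theorem eq_zero_of_smul_mem {K : Submodule R X} (hK : ReflectsFiniteSystems e K) {r : R}
    (hr : r • e ∈ K) : r = 0 := by
  obtain ⟨y, hy⟩ := hK Unit Empty (fun _ => Empty.elim) (fun _ => r) Empty.elim (by simpa using hr)
  simpa using hy ()

theorem exists_sub_smul_mem [IsNoetherianRing R] [IsLocalRing R]
    [IsAdicComplete (IsLocalRing.maximalIdeal R) R] {K : Submodule R X}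
    (hK : Maximal (ReflectsFiniteSystems e) K) (q : X) : ∃ r : R, q - r • e ∈ K := by
  let S : Set (Set R) := {C | ∃ (ι κ : Type) (_ : Fintype ι) (_ : Fintype κ) (A : ι → κ → R)
    (b c : ι → R) (x : κ → X), (∀ i, b i • e + c i • q - ∑ l, A i l • x l ∈ K) ∧
      C = {r | ∃ y : κ → R, ∀ i, b i + c i * r = ∑ l, A i l * y l}}
  obtain ⟨r, hr⟩ := exists_mem_of_isAdicComplete S (by
    rintro _ ⟨ι, κ, _, _, A, b, c, x, h, rfl⟩
    obtain ⟨y₀, hy₀⟩ := hK.1 ι (Option κ) (fun i o => o.elim (- c i) (A i)) b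
      (fun o => o.elim q x) (fun i => by
        convert h i using 1
        rw [Fintype.sum_option]
        simp only [Option.elim]
        module)
    simp only [Fintype.sum_option, Option.elim] at hy₀
    refine ⟨y₀ none, (LinearMap.range (Matrix.mulVecLin (Matrix.of A))).comap
      (LinearMap.toSpanSingleton R (ι → R) c), ?_⟩
    ext r
    simp only [Set.mem_ofPred_eq, Submodule.mem_comap, LinearMap.mem_range,
      LinearMap.toSpanSingleton_apply, funext_iff, Matrix.mulVecLin_apply, Matrix.mulVec,
      dotProduct, Matrix.of_apply, Pi.smul_apply, smul_eq_mul]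
    constructor
    · rintro ⟨y, hy⟩
      refine ⟨fun l => y l - y₀ (some l), fun i => ?_⟩
      simp only [mul_sub, Finset.sum_sub_distrib]
      linear_combination hy₀ i - hy i
    · rintro ⟨y, hy⟩
      refine ⟨fun l => y l + y₀ (some l), fun i => ?_⟩
      simp only [mul_add, Finset.sum_add_distrib]
      linear_combination hy₀ i - hy i) (by
    rintro _ ⟨ι, κ, _, _, A, b, c, x, h, rfl⟩ _ ⟨ι', κ', _, _, A', b', c', x', h', rfl⟩
    refine ⟨ι ⊕ ι', κ ⊕ κ', inferInstance, inferInstance,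
      Sum.elim (fun i => Sum.elim (A i) 0) (fun i => Sum.elim 0 (A' i)),
      Sum.elim b b', Sum.elim c c', Sum.elim x x', ?_, ?_⟩
    · rintro (i | i)
      · simpa using h i
      · simpa using h' i
    · ext r
      simp only [Set.mem_inter_iff, Set.mem_ofPred_eq, Sum.forall, Sum.elim_inl, Sum.elim_inr,
        Fintype.sum_sum_type, Pi.zero_apply, zero_mul, Finset.sum_const_zero, add_zero, zero_add]
      constructor
      · rintro ⟨⟨y, hy⟩, ⟨y', hy'⟩⟩
        exact ⟨Sum.elim y y', hy, hy'⟩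
      · rintro ⟨y, hy, hy'⟩
        exact ⟨⟨_, hy⟩, ⟨_, hy'⟩⟩)
  refine ⟨r, ?_⟩
  have hgood : ReflectsFiniteSystems e (K ⊔ R ∙ (q - r • e)) := fun ι κ _ _ A b x h => by
    have hc (i : ι) : ∃ c : R, b i • e - ∑ l, A i l • x l - c • (q - r • e) ∈ K := by
      obtain ⟨k, hk, z, hz, hkz⟩ := Submodule.mem_sup.1 (h i)
      obtain ⟨c, rfl⟩ := Submodule.mem_span_singleton.1 hz
      exact ⟨c, by rwa [← hkz, add_sub_cancel_right]⟩
    choose c hc using hc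
    obtain ⟨y, hy⟩ := hr _ ⟨ι, κ, inferInstance, inferInstance, A, fun i => b i + c i * r,
      fun i => - c i, x, fun i => by convert hc i using 1; module, rfl⟩
    exact ⟨y, fun i => by rw [← hy i]; ring⟩
  exact hK.2 hgood le_sup_left (Submodule.mem_sup_right (Submodule.mem_span_singleton_self _))

end ReflectsFiniteSystems

theorem IsPureMono.reflectsFiniteSystems {R : Type u} [CommRing R] {M N : Type u}
    [AddCommGroup M] [Module R M] [AddCommGroup N] [Module R N] {f : M →ₗ[R] N}
    (hf : IsPureMono R f) (g : M →ₗ[R] R) :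
    ReflectsFiniteSystems ((0, 1) : N × R) (LinearMap.range (f.prod (-g))) := by
  intro ι κ _ _ A b x h
  choose m hm using h
  have h₁ (i : ι) : f (- m i) = ∑ l, A i l • (x l).1 := by
    have := congrArg Prod.fst (hm i)
    simp [Prod.fst_sum] at this
    simp [this]
  have h₂ (i : ι) : - g (m i) = b i - ∑ l, A i l * (x l).2 := by
    have := congrArg Prod.snd (hm i)
    simpa [Prod.snd_sum] using this
  obtain ⟨m', hm'⟩ := hf.exists_solution A _ _ h₁
  refine ⟨fun l => g (m' l) + (x l).2, fun i => ?_⟩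
  have h₃ := congrArg g (hm' i)
  simp only [map_neg, map_sum, map_smul, smul_eq_mul] at h₃
  simp only [mul_add, Finset.sum_add_distrib]
  linear_combination h₃ - h₂ i

theorem complete_local_pureInjective (R : Type u) [CommRing R] [IsNoetherianRing R]
    [IsLocalRing R] [IsAdicComplete (IsLocalRing.maximalIdeal R) R] :
    IsPureInjective R R := by
  intro M N _ _ _ _ f hf g
  obtain ⟨K, hle, hK⟩ := (hf.reflectsFiniteSystems g).exists_maximal
  have huniq {n : N} {r s : R} (hr : (n, -r) ∈ K) (hs : (n, -s) ∈ K) : r = s := by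
    refine (sub_eq_zero.1 (hK.1.eq_zero_of_smul_mem ?_)).symm
    have := K.sub_mem hr hs
    simpa [neg_add_eq_sub] using this
  have hex (n : N) : ∃ r : R, (n, -r) ∈ K := by
    obtain ⟨r, hr⟩ := ReflectsFiniteSystems.exists_sub_smul_mem hK (n, 0)
    exact ⟨r, by simpa using hr⟩
  choose h hh using hex
  refine ⟨{ toFun := h, map_add' := fun a b => ?_, map_smul' := fun c a => ?_ }, ?_⟩
  · refine huniq (hh _) ?_
    simpa [add_comm] using K.add_mem (hh a) (hh b)
  · refine huniq (hh _) ?_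
    simpa using K.smul_mem c (hh a)
  · ext m
    exact huniq (hh _) (hle ⟨m, rfl⟩)
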